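/- Let F be a finite field with q elements, let A₃* denote the set of nonnegative integers none of whose base-3 digits equals 2, and let S = {f ∈ F[X] : f ≠ 0 and deg f ∈ A₃*}. Then the upper density of S equals m_q = (1 − q^(−2)) · ∏_{i=1}^∞ (1 + q^(−3^i)); that is, limsup as N → ∞ of |{f ∈ S : deg f ≤ N}| / q^(N+1) equals m_q. -/

import Mathlib

/-- `A3` is the set of nonnegative integers none of whose base-3 digits equals 2. -/
def A3 : Set ℕ := {n : ℕ | ∀ d ∈ Nat.digits 3 n, d ≠ 2}

/-- The increasing enumeration of `A3`: binary digits of `n` read in base 3. -/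
def a3 (n : ℕ) : ℕ := Nat.ofDigits 3 (Nat.digits 2 n)

lemma a3_zero : a3 0 = 0 := by simp [a3]

lemma a3_eq (n : ℕ) : a3 n = 3 * a3 (n / 2) + n % 2 := by
  rcases Nat.eq_zero_or_pos n with rfl | h
  · simp [a3]
  · unfold a3
    rw [Nat.digits_def' (by norm_num) h, Nat.ofDigits_cons, add_comm]

lemma a3_superadditive (i j : ℕ) : a3 i + a3 j ≤ a3 (i + j) := by
  induction h : i + j using Nat.strong_induction_on generalizing i j with
  | _ n ih =>
    subst h
    rcases Nat.eq_zero_or_pos i with rfl | hi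
    · simp [a3_zero]
    rcases Nat.eq_zero_or_pos j with rfl | hj
    · simp [a3_zero]
    have h1 := ih (i / 2 + j / 2) (by omega) _ _ rfl
    have hi' := a3_eq i
    have hj' := a3_eq j
    have hs := a3_eq (i + j)
    have a1 : a3 1 = 1 := by simp [a3]
    by_cases hc : i % 2 = 1 ∧ j % 2 = 1
    · have h2 := ih (i / 2 + j / 2 + 1) (by omega) _ _ rfl
      rw [show (i + j) / 2 = i / 2 + j / 2 + 1 by omega] at hs
      omega
    · rw [show (i + j) / 2 = i / 2 + j / 2 by omega] at hs
      omega

lemma a3_strictMono : StrictMono a3 := by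
  refine strictMono_nat_of_lt_succ fun n => ?_
  have h := a3_superadditive n 1
  have a1 : a3 1 = 1 := by simp [a3]
  omega

lemma mem_A3_iff (n : ℕ) : n ∈ A3 ↔ n % 3 ≠ 2 ∧ n / 3 ∈ A3 := by
  rcases Nat.eq_zero_or_pos n with rfl | h
  · simp [A3]
  · simp only [A3, Set.mem_ofPred_eq]
    rw [Nat.digits_def' (by norm_num) h]
    simp

lemma a3_mem (n : ℕ) : a3 n ∈ A3 := by
  induction n using Nat.strong_induction_on with
  | _ n ih =>
    rcases Nat.eq_zero_or_pos n with rfl | h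
    · simp [A3, a3_zero]
    · have := ih (n / 2) (by omega)
      have e := a3_eq n
      rw [mem_A3_iff, show a3 n / 3 = a3 (n / 2) by omega]
      exact ⟨by omega, this⟩

lemma exists_a3_eq {n : ℕ} (hn : n ∈ A3) : ∃ i, a3 i = n := by
  induction n using Nat.strong_induction_on with
  | _ n ih =>
    rcases Nat.eq_zero_or_pos n with rfl | h
    · exact ⟨0, a3_zero⟩
    · rw [mem_A3_iff] at hn
      obtain ⟨i, hi⟩ := ih (n / 3) (by omega) hn.2
      refine ⟨2 * i + n % 3, ?_⟩
      rw [a3_eq, show (2 * i + n % 3) / 2 = i by omega]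
      omega

lemma a3_le_of_lt_two_pow (k : ℕ) {i : ℕ} (hi : i < 2 ^ k) :
    a3 i ≤ ∑ j ∈ Finset.range k, 3 ^ j := by
  induction k generalizing i with
  | zero => simp_all [a3_zero]
  | succ k ih =>
    have h := ih (i := i / 2) (by omega)
    rw [Finset.sum_range_succ', a3_eq]
    simp only [pow_succ, ← Finset.sum_mul]
    omega

lemma sum_range_two_mul {M : Type*} [AddCommMonoid M] (f : ℕ → M) (n : ℕ) :
    ∑ i ∈ Finset.range (2 * n), f i = ∑ i ∈ Finset.range n, (f (2 * i) + f (2 * i + 1)) := by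
  induction n with
  | zero => simp
  | succ n ih => rw [mul_add, mul_one, Finset.sum_range_succ, Finset.sum_range_succ, ih,
      Finset.sum_range_succ, add_assoc]

lemma sum_pow_a3 {R : Type*} [CommSemiring R] (x : R) (k : ℕ) :
    ∑ i ∈ Finset.range (2 ^ k), x ^ a3 i = ∏ i ∈ Finset.range k, (1 + x ^ 3 ^ i) := by
  induction k generalizing x with
  | zero => simp [a3_zero]
  | succ k ih =>
    rw [pow_succ', sum_range_two_mul, Finset.prod_range_succ']
    simp only [pow_succ', pow_mul x 3]
    rw [← ih, Finset.sum_mul]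
    refine Finset.sum_congr rfl fun i _ => ?_
    rw [a3_eq (2 * i), a3_eq (2 * i + 1), show 2 * i / 2 = i by omega,
      show (2 * i + 1) / 2 = i by omega, show 2 * i % 2 = 0 by omega,
      show (2 * i + 1) % 2 = 1 by omega, pow_add, pow_add, pow_mul]
    ring

open Polynomial in
lemma finite_and_ncard_natDegree_eq (F : Type*) [Field F] [Fintype F] (n : ℕ) :
    {f : F[X] | f ≠ 0 ∧ f.natDegree = n}.Finite ∧
      (Set.ncard {f : F[X] | f ≠ 0 ∧ f.natDegree = n} : ℝ) =
        (Fintype.card F - 1) * (Fintype.card F : ℝ) ^ n := by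
  have hfin (m : ℕ) : (degreeLT F m : Set F[X]).Finite :=
    Finite.of_equiv _ (degreeLTEquiv F m).toEquiv.symm
  have hcard (m : ℕ) : (degreeLT F m : Set F[X]).ncard = Fintype.card F ^ m := by
    rw [← Nat.card_coe_set_eq]
    exact (Nat.card_congr (degreeLTEquiv F m).toEquiv).trans (by simp)
  have hset : {f : F[X] | f ≠ 0 ∧ f.natDegree = n} =
      (degreeLT F (n + 1) : Set F[X]) \ degreeLT F n := by
    ext f
    by_cases hf : f = 0
    · simp [hf]
    · simp only [Set.mem_ofPred_eq, Set.mem_sdiff, SetLike.mem_coe, mem_degreeLT,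
        ← natDegree_lt_iff_degree_lt hf, ne_eq, hf, not_false_eq_true, true_and]
      omega
  have hsub : (degreeLT F n : Set F[X]) ⊆ degreeLT F (n + 1) := degreeLT_mono n.le_succ
  refine ⟨hset ▸ (hfin _).sdiff, ?_⟩
  have h := Set.ncard_sdiff_add_ncard_of_subset hsub (hfin _)
  rw [← hset, hcard, hcard] at h
  have h' := congrArg (Nat.cast : ℕ → ℝ) h
  push_cast at h'
  linear_combination h'

open Polynomial in
lemma ncard_natDegree_mem (F : Type*) [Field F] [Fintype F] (A : Set ℕ) [DecidablePred (· ∈ A)]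
    (N : ℕ) :
    (Set.ncard {f : F[X] | f ≠ 0 ∧ f.natDegree ∈ A ∧ f.natDegree ≤ N} : ℝ) =
      (Fintype.card F - 1) * ∑ n ∈ Finset.range (N + 1) with n ∈ A, (Fintype.card F : ℝ) ^ n := by
  have hset : {f : F[X] | f ≠ 0 ∧ f.natDegree ∈ A ∧ f.natDegree ≤ N} =
      ⋃ n : {n // n ∈ (Finset.range (N + 1)).filter (· ∈ A)},
        {f : F[X] | f ≠ 0 ∧ f.natDegree = n} := by
    ext f
    simp
    tauto
  rw [hset, Set.ncard_iUnion_of_finite]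
  · rw [finsum_eq_sum_of_fintype, Finset.mul_sum]
    push_cast
    simp only [(finite_and_ncard_natDegree_eq F _).2]
    exact Finset.sum_coe_sort _ fun n => ((Fintype.card F : ℝ) - 1) * (Fintype.card F : ℝ) ^ n
  · exact fun n => (finite_and_ncard_natDegree_eq F n).1
  · intro m n hmn
    refine Set.disjoint_left.2 fun f hm hn => hmn (Subtype.ext (hm.2.symm.trans hn.2))

lemma sum_pow_A3_le {q : ℝ} (hq : 1 < q) [DecidablePred (· ∈ A3)] (N : ℕ) :
    ∃ k, ∑ n ∈ Finset.range (N + 1) with n ∈ A3, q ^ n ≤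
      q ^ N * ∏ i ∈ Finset.range k, (1 + q⁻¹ ^ 3 ^ i) := by
  have hq0 : 0 < q := by linarith
  set m := Nat.findGreatest (fun i => a3 i ≤ N) N
  have ham : a3 m ≤ N :=
    Nat.findGreatest_spec (P := fun i => a3 i ≤ N) (Nat.zero_le N) (by simp [a3_zero])
  refine ⟨m + 1, ?_⟩
  have hsub : (Finset.range (N + 1)).filter (· ∈ A3) ⊆ (Finset.range (m + 1)).image a3 := by
    intro n hn
    obtain ⟨hn1, hn2⟩ := Finset.mem_filter.1 hn
    obtain ⟨i, rfl⟩ := exists_a3_eq hn2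
    have hle : a3 i ≤ N := Nat.lt_succ_iff.1 (Finset.mem_range.1 hn1)
    exact Finset.mem_image_of_mem _ (Finset.mem_range.2 (Nat.lt_succ_iff.2
      (Nat.le_findGreatest ((a3_strictMono.le_apply).trans hle) hle)))
  calc ∑ n ∈ Finset.range (N + 1) with n ∈ A3, q ^ n
      ≤ ∑ n ∈ (Finset.range (m + 1)).image a3, q ^ n :=
        Finset.sum_le_sum_of_subset_of_nonneg hsub fun _ _ _ => by positivity
    _ = ∑ i ∈ Finset.range (m + 1), q ^ a3 i :=
        Finset.sum_image fun _ _ _ _ h => a3_strictMono.injective h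
    _ ≤ ∑ i ∈ Finset.range (m + 1), q ^ N * q⁻¹ ^ a3 (m - i) := by
        refine Finset.sum_le_sum fun i hi => ?_
        have h := a3_superadditive i (m - i)
        have hi' := Finset.mem_range.1 hi
        rw [Nat.add_sub_cancel' (by omega)] at h
        rw [inv_pow, ← div_eq_mul_inv, le_div_iff₀ (by positivity), ← pow_add]
        exact pow_le_pow_right₀ hq.le (by omega)
    _ = q ^ N * ∑ i ∈ Finset.range (m + 1), q⁻¹ ^ a3 i := by
        rw [← Finset.mul_sum, ← Finset.sum_range_reflect (fun i => q⁻¹ ^ a3 i)]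
        simp
    _ ≤ q ^ N * ∑ i ∈ Finset.range (2 ^ (m + 1)), q⁻¹ ^ a3 i := by
        gcongr
        exact Nat.lt_two_pow_self.le
    _ = _ := by rw [sum_pow_a3]

lemma le_sum_pow_A3 {q : ℝ} (hq : 0 < q) [DecidablePred (· ∈ A3)] (k : ℕ) :
    q ^ (∑ j ∈ Finset.range k, 3 ^ j) * ∏ i ∈ Finset.range k, (1 + q⁻¹ ^ 3 ^ i) ≤
      ∑ n ∈ Finset.range (∑ j ∈ Finset.range k, 3 ^ j + 1) with n ∈ A3, q ^ n := by
  calc _ = ∏ i ∈ Finset.range k, (1 + q ^ 3 ^ i) := by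
        rw [← Finset.prod_pow_eq_pow_sum, ← Finset.prod_mul_distrib]
        refine Finset.prod_congr rfl fun i _ => ?_
        rw [mul_add, ← mul_pow, mul_inv_cancel₀ hq.ne']
        ring
    _ = ∑ i ∈ Finset.range (2 ^ k), q ^ a3 i := (sum_pow_a3 q k).symm
    _ = ∑ n ∈ (Finset.range (2 ^ k)).image a3, q ^ n :=
        (Finset.sum_image fun _ _ _ _ h => a3_strictMono.injective h).symm
    _ ≤ _ := by
        refine Finset.sum_le_sum_of_subset_of_nonneg (fun n hn => ?_) fun _ _ _ => by positivity
        obtain ⟨i, hi, rfl⟩ := Finset.mem_image.1 hn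
        exact Finset.mem_filter.2 ⟨Finset.mem_range.2 (Nat.lt_succ_iff.2
          (a3_le_of_lt_two_pow k (Finset.mem_range.1 hi))), a3_mem i⟩

lemma multipliable_one_add_pow_three_pow {x : ℝ} (h0 : 0 ≤ x) (h1 : x < 1) :
    Multipliable fun i : ℕ => 1 + x ^ 3 ^ (i + 1) := by
  refine Real.multipliable_one_add_of_summable ?_
  refine (summable_geometric_of_lt_one h0 h1).of_nonneg_of_le (fun i => by positivity) fun i => ?_
  refine pow_le_pow_of_le_one h0 h1.le ?_
  exact (Nat.lt_pow_self (by norm_num)).le.trans (Nat.pow_le_pow_right (by norm_num) i.le_succ)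

theorem stmt_13 (F : Type*) [Field F] [Fintype F] (q : ℕ) (hq : Fintype.card F = q) :
    Filter.limsup
      (fun N : ℕ =>
        (Set.ncard {f : Polynomial F | f ≠ 0 ∧ f.natDegree ∈ A3 ∧ f.natDegree ≤ N} : ℝ) /
          (q : ℝ) ^ (N + 1))
      Filter.atTop =
    (1 - (q : ℝ) ^ (-2 : ℤ)) * ∏' i : ℕ, (1 + (q : ℝ) ^ (-(3 : ℤ) ^ (i + 1))) := by
  classical
  subst hq
  have hq1 : (1 : ℝ) < Fintype.card F := by exact_mod_cast Fintype.one_lt_card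
  simp only [ncard_natDegree_mem]
  generalize (Fintype.card F : ℝ) = q at *
  have hq0 : 0 < q := by linarith
  have hx0 : 0 < q⁻¹ := by positivity
  have hx1 : q⁻¹ < 1 := inv_lt_one_of_one_lt₀ hq1
  have hpow (i : ℕ) : q ^ (-(3 : ℤ) ^ (i + 1)) = q⁻¹ ^ 3 ^ (i + 1) := by
    rw [zpow_neg, inv_pow, ← zpow_natCast]
    norm_cast
  simp only [hpow]
  have hmul := multipliable_one_add_pow_three_pow hx0.le hx1
  set P := ∏' i : ℕ, (1 + q⁻¹ ^ 3 ^ (i + 1))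
  have htend : Filter.Tendsto
      (fun k => (1 - q⁻¹) * ∏ i ∈ Finset.range k, (1 + q⁻¹ ^ 3 ^ i)) Filter.atTop
      (nhds ((1 - q ^ (-2 : ℤ)) * P)) := by
    rw [← Filter.tendsto_add_atTop_iff_nat 1]
    have h := hmul.hasProd.tendsto_prod_nat.const_mul (1 - q ^ (-2 : ℤ))
    refine h.congr fun k => ?_
    rw [Finset.prod_range_succ', pow_zero, pow_one, zpow_neg]
    norm_cast
    ring
  have hmono : Monotone
      (fun k => (1 - q⁻¹) * ∏ i ∈ Finset.range k, (1 + q⁻¹ ^ 3 ^ i)) := by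
    refine monotone_nat_of_le_succ fun k => ?_
    rw [Finset.prod_range_succ]
    refine mul_le_mul_of_nonneg_left ?_ (by linarith)
    exact le_mul_of_one_le_right (Finset.prod_nonneg fun _ _ => by positivity)
      (le_add_of_nonneg_right (by positivity))
  have hupper (N : ℕ) : ((q - 1) * ∑ n ∈ Finset.range (N + 1) with n ∈ A3, q ^ n) / q ^ (N + 1) ≤
      (1 - q ^ (-2 : ℤ)) * P := by
    obtain ⟨k, hk⟩ := sum_pow_A3_le hq1 N
    refine le_trans ?_ (hmono.ge_of_tendsto htend k)
    rw [div_le_iff₀ (by positivity)]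
    refine (mul_le_mul_of_nonneg_left hk (by linarith)).trans_eq ?_
    rw [pow_succ]
    linear_combination
      (q ^ N * ∏ i ∈ Finset.range k, (1 + q⁻¹ ^ 3 ^ i)) * inv_mul_cancel₀ hq0.ne'
  have hlower (k : ℕ) : (1 - q⁻¹) * ∏ i ∈ Finset.range k, (1 + q⁻¹ ^ 3 ^ i) ≤
      ((q - 1) * ∑ n ∈ Finset.range (∑ j ∈ Finset.range k, 3 ^ j + 1) with n ∈ A3, q ^ n) /
        q ^ (∑ j ∈ Finset.range k, 3 ^ j + 1) := by
    rw [le_div_iff₀ (by positivity)]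
    refine le_trans (Eq.le ?_)
      (mul_le_mul_of_nonneg_left (le_sum_pow_A3 hq0 k) (by linarith : 0 ≤ q - 1))
    rw [pow_succ]
    linear_combination (-q ^ (∑ j ∈ Finset.range k, 3 ^ j) *
      ∏ i ∈ Finset.range k, (1 + q⁻¹ ^ 3 ^ i)) * inv_mul_cancel₀ hq0.ne'
  have hbdd : Filter.IsBoundedUnder (· ≤ ·) Filter.atTop fun N : ℕ =>
      ((q - 1) * ∑ n ∈ Finset.range (N + 1) with n ∈ A3, q ^ n) / q ^ (N + 1) :=
    Filter.isBoundedUnder_of ⟨_, hupper⟩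
  have hcobdd : Filter.IsCoboundedUnder (· ≤ ·) Filter.atTop fun N : ℕ =>
      ((q - 1) * ∑ n ∈ Finset.range (N + 1) with n ∈ A3, q ^ n) / q ^ (N + 1) := by
    refine (Filter.isBoundedUnder_of ⟨0, fun N => ?_⟩).isCoboundedUnder_le
    have : 0 ≤ q - 1 := by linarith
    positivity
  refine le_antisymm
    (Filter.limsup_le_of_le hcobdd (Filter.Eventually.of_forall hupper)) ?_
  refine le_of_forall_lt fun b hb => ?_
  obtain ⟨c, hbc, hc⟩ := exists_between hb
  refine hbc.trans_le (Filter.le_limsup_of_frequently_le ?_ hbdd)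
  have hN : Filter.Tendsto (fun k => ∑ j ∈ Finset.range k, 3 ^ j) Filter.atTop Filter.atTop :=
    Filter.tendsto_atTop_mono (fun k => by
      simpa using Finset.sum_le_sum fun j (_ : j ∈ Finset.range k) =>
        Nat.one_le_pow j 3 (by norm_num)) Filter.tendsto_id
  refine hN.frequently (Filter.Eventually.frequently ?_)
  filter_upwards [htend.eventually_const_lt hc] with k hk
  exact hk.le.trans (hlower k)
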